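/- arXiv:math/0502119 — 2 statements merged into one kernel-verified Lean document; each statement's English description precedes it below -/
import Mathlib

section
/- If λ is a symmetric partition of n and T is a standard Young tableau of shape λ, then w(T)·w(T') = (−1)^{ν(λ)}; equivalently, #{(i,j) : i < j and col_T(i) > col_T(j)} + #{(i,j) : i < j and row_T(i) > row_T(j)} ≡ ν(λ) (mod 2). -/
/-- A partition: a weakly decreasing sequence of naturals, almost all zero.
`l i` is the length of row `i + 1` (rows are 0-indexed, so `l i = λ_{i+1}`). -/
def IsPart (l : ℕ → ℕ) : Prop :=
  (∀ i, l (i + 1) ≤ l i) ∧ ∃ N, ∀ i, N ≤ i → l i = 0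

/-- The set of cells `(row, column)` (0-indexed) of the Young diagram of `l`. -/
def pcells (l : ℕ → ℕ) : Set (ℕ × ℕ) := {p | p.2 < l p.1}

/-- The size `|λ|` of the partition (number of cells of its Young diagram). -/
noncomputable def psize (l : ℕ → ℕ) : ℕ := Nat.card (pcells l)

/-- The conjugate (transposed) partition `λ'`: `pconj l j = #{i : λ_{i+1} ≥ j+1}`. -/
noncomputable def pconj (l : ℕ → ℕ) : ℕ → ℕ := fun j => Nat.card {i : ℕ | j < l i}

/-- `μ ↗ λ` : `μ_i ≤ λ_i` for all `i` and `|μ| = |λ| - 1`. -/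
def PCovers (m l : ℕ → ℕ) : Prop := (∀ i, m i ≤ l i) ∧ psize m + 1 = psize l

/-- `b(λ)`, the length of the diagonal of `λ` (number of `i ≥ 1` with `λ_i ≥ i`). -/
noncomputable def pdiag (l : ℕ → ℕ) : ℕ := Nat.card {i : ℕ | i < l i}

/-- `δ(λ)`, the number of descents (removable corners) of `λ`. -/
noncomputable def pdelta (l : ℕ → ℕ) : ℕ := Nat.card {r : ℕ | l (r + 1) < l r}

/-- `λ^{(r)}` for the descent at 0-indexed row `r`: decrease that row by one. -/
def premove (l : ℕ → ℕ) (r : ℕ) : ℕ → ℕ := Function.update l r (l r - 1)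

/-- `T` is a standard Young tableau of shape `l`: a bijective labelling of the cells
by `1, …, n` which is strictly increasing along each row and each column
(and `0` outside the diagram, to pin the function down). -/
def IsSYT (l : ℕ → ℕ) (T : ℕ × ℕ → ℕ) : Prop :=
  Set.BijOn T (pcells l) (Set.Icc 1 (psize l)) ∧
  (∀ p ∈ pcells l, ∀ q ∈ pcells l, p.1 = q.1 → p.2 < q.2 → T p < T q) ∧
  (∀ p ∈ pcells l, ∀ q ∈ pcells l, p.2 = q.2 → p.1 < q.1 → T p < T q) ∧
  (∀ p, p ∉ pcells l → T p = 0)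

/-- `f(λ)`, the number of standard Young tableaux of shape `l`. -/
noncomputable def sytCount (l : ℕ → ℕ) : ℕ := Nat.card {T : ℕ × ℕ → ℕ // IsSYT l T}

/-- `ν(λ)`, the number of shifts (décalages) of `λ`: pairs of cells
`((i₁,j₁),(i₂,j₂))` of `λ` with `i₁ < i₂` and `j₁ > j₂`. -/
noncomputable def pshifts (l : ℕ → ℕ) : ℕ :=
  Nat.card {pq : (ℕ × ℕ) × (ℕ × ℕ) | pq.1 ∈ pcells l ∧ pq.2 ∈ pcells l ∧
    pq.1.1 < pq.2.1 ∧ pq.2.2 < pq.1.2}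

/-- The number of column inversions of a tableau `T`:
pairs of entries `i < j` with `col_T(i) > col_T(j)`, counted as pairs of cells
`(p, q)` with `T p < T q` and `p` in a strictly larger column than `q`.
Then `w(T) = (-1)` to this count. -/
noncomputable def colInv (l : ℕ → ℕ) (T : ℕ × ℕ → ℕ) : ℕ :=
  Nat.card {pq : (ℕ × ℕ) × (ℕ × ℕ) | pq.1 ∈ pcells l ∧ pq.2 ∈ pcells l ∧
    T pq.1 < T pq.2 ∧ pq.2.2 < pq.1.2}

/-- The number of row inversions of a tableau `T`:
pairs of entries `i < j` with `row_T(i) > row_T(j)`; this is the number of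
column inversions of the transposed tableau `T'`. -/
noncomputable def rowInv (l : ℕ → ℕ) (T : ℕ × ℕ → ℕ) : ℕ :=
  Nat.card {pq : (ℕ × ℕ) × (ℕ × ℕ) | pq.1 ∈ pcells l ∧ pq.2 ∈ pcells l ∧
    T pq.1 < T pq.2 ∧ pq.2.1 < pq.1.1}

theorem aux_anti (l : ℕ → ℕ) (hl : IsPart l) : Antitone l := antitone_nat_of_succ_le hl.1

theorem aux_fin (l : ℕ → ℕ) (hl : IsPart l) : (pcells l).Finite := by
  obtain ⟨N, hN⟩ := hl.2
  refine ((Set.finite_Iio N).prod (Set.finite_Iio (l 0))).subset ?_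
  rintro ⟨i, j⟩ h
  have h' : j < l i := h
  have h2 := aux_anti l hl (Nat.zero_le i)
  refine ⟨?_, lt_of_lt_of_le h' h2⟩
  by_contra hc
  have := hN i (by simpa using hc)
  omega

theorem aux_mono (l : ℕ → ℕ) (hl : IsPart l) (T : ℕ × ℕ → ℕ) (hT : IsSYT l T)
    (p q : ℕ × ℕ) (hp : p ∈ pcells l) (hq : q ∈ pcells l) (h1 : p.1 ≤ q.1) (h2 : p.2 ≤ q.2) :
    T p ≤ T q := by
  obtain ⟨i, j⟩ := p
  obtain ⟨i', j'⟩ := q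
  simp only at h1 h2
  have hq' : j' < l i' := hq
  have hm : (i, j') ∈ pcells l := lt_of_lt_of_le hq' (aux_anti l hl h1)
  have e1 : T (i, j) ≤ T (i, j') := by
    rcases h2.lt_or_eq with h | h
    · exact (hT.2.1 _ hp _ hm rfl h).le
    · rw [h]
  have e2 : T (i, j') ≤ T (i', j') := by
    rcases h1.lt_or_eq with h | h
    · exact (hT.2.2.1 _ hm _ hq rfl h).le
    · rw [h]
  exact e1.trans e2

theorem aux_main (l : ℕ → ℕ) (hl : IsPart l) (T : ℕ × ℕ → ℕ) (hT : IsSYT l T) :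
    colInv l T + rowInv l T = pshifts l := by
  have hf := (aux_fin l hl).prod (aux_fin l hl)
  unfold colInv rowInv pshifts
  simp only [Nat.card_coe_set_eq]
  set A := {pq : (ℕ × ℕ) × (ℕ × ℕ) | pq.1 ∈ pcells l ∧ pq.2 ∈ pcells l ∧
    T pq.1 < T pq.2 ∧ pq.2.2 < pq.1.2} with hA
  set B := {pq : (ℕ × ℕ) × (ℕ × ℕ) | pq.1 ∈ pcells l ∧ pq.2 ∈ pcells l ∧
    T pq.1 < T pq.2 ∧ pq.2.1 < pq.1.1} with hB
  have fA : A.Finite := hf.subset fun x hx => ⟨hx.1, hx.2.1⟩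
  have fB : B.Finite := hf.subset fun x hx => ⟨hx.1, hx.2.1⟩
  rw [← Set.ncard_image_of_injective B Prod.swap_injective,
    ← Set.ncard_union_eq ?_ fA (fB.image _)]
  · congr 1
    ext ⟨p, q⟩
    simp only [Set.mem_union, Set.image_swap_eq_preimage_swap, Set.mem_preimage, Prod.swap_prod_mk,
      hA, hB, Set.mem_setOf_eq]
    constructor
    · rintro (⟨hp, hq, h, h'⟩ | ⟨hp, hq, h, h'⟩)
      · refine ⟨hp, hq, ?_, h'⟩
        by_contra hc
        have := aux_mono l hl T hT q p hq hp (by omega) (by omega)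
        omega
      · refine ⟨hq, hp, h', ?_⟩
        by_contra hc
        have := aux_mono l hl T hT p q hq hp (by omega) (by omega)
        omega
    · rintro ⟨hp, hq, h, h'⟩
      rcases lt_trichotomy (T p) (T q) with c | c | c
      · exact Or.inl ⟨hp, hq, c, h'⟩
      · have := hT.1.injOn hp hq c
        subst this
        omega
      · exact Or.inr ⟨hq, hp, c, h⟩
  · rw [Set.disjoint_left]
    rintro _ ha ⟨y, hy, rfl⟩
    have h1 : T y.2 < T y.1 := ha.2.2.1
    have h2 := hy.2.2.1
    omega

/-- If `λ` is a symmetric partition and `T` is a standard Young tableau of shape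
`λ`, then `w(T) · w(T') = (-1) ^ ν(λ)`; equivalently the number of column
inversions of `T` plus the number of row inversions of `T` is congruent to
`ν(λ)` modulo 2. -/
theorem w_mul_w_transpose (l : ℕ → ℕ) (hl : IsPart l) (hsym : pconj l = l)
    (T : ℕ × ℕ → ℕ) (hT : IsSYT l T) :
    ((-1 : ℤ) ^ colInv l T * (-1 : ℤ) ^ rowInv l T = (-1 : ℤ) ^ pshifts l) ∧
    colInv l T + rowInv l T ≡ pshifts l [MOD 2] := by
  have h := aux_main l hl T hT
  rw [← pow_add, h]
  exact ⟨rfl, rfl⟩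
end

section
/- If λ is a partition of n with n ≥ 6 and f(λ) ≠ 1, then f(λ) > 2·δ(λ). -/
lemma ispart_anti {l : ℕ → ℕ} (hl : IsPart l) : Antitone l := antitone_nat_of_succ_le hl.1

lemma pcells_finite {l : ℕ → ℕ} (hl : IsPart l) : (pcells l).Finite := by
  obtain ⟨N, hN⟩ := hl.2
  refine ((Set.finite_Iio N).prod (Set.finite_Iio (l 0))).subset ?_
  rintro ⟨i, j⟩ h
  simp only [pcells, Set.mem_ofPred_eq] at h
  refine ⟨?_, lt_of_lt_of_le h (ispart_anti hl (Nat.zero_le i))⟩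
  by_contra hc
  simp only [Set.mem_Iio, not_lt] at hc
  rw [hN i hc] at h
  omega

lemma psize_sum {l : ℕ → ℕ} (N : ℕ) (hN : ∀ i, N ≤ i → l i = 0) :
    psize l = ∑ i ∈ Finset.range N, l i := by
  have : pcells l = (((Finset.range N).sigma (fun i => Finset.range (l i))).map
      (Equiv.sigmaEquivProd ℕ ℕ).toEmbedding : Finset (ℕ × ℕ)) := by
    ext ⟨i, j⟩
    simp only [pcells, Set.mem_ofPred_eq, Finset.coe_map, Set.mem_image, Finset.mem_coe,
      Finset.mem_sigma, Finset.mem_range, Sigma.exists]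
    constructor
    · intro h
      refine ⟨i, j, ⟨?_, h⟩, rfl⟩
      by_contra hc
      rw [hN i (by omega)] at h
      omega
    · rintro ⟨a, b, ⟨_, h⟩, e⟩
      simp only [Equiv.coe_toEmbedding, Equiv.sigmaEquivProd_apply, Prod.mk.injEq] at e
      obtain ⟨rfl, rfl⟩ := e
      exact h
  rw [psize, this, Nat.card_coe_set_eq, Set.ncard_coe_finset, Finset.card_map, Finset.card_sigma]
  simp

lemma syt_finite {l : ℕ → ℕ} (hl : IsPart l) : Finite {T : ℕ × ℕ → ℕ // IsSYT l T} := by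
  have := (pcells_finite hl).to_subtype
  refine Finite.of_injective
    (fun T : {T : ℕ × ℕ → ℕ // IsSYT l T} => fun p : pcells l =>
      (⟨T.1 p, T.2.1.mapsTo p.2⟩ : Set.Icc 1 (psize l))) ?_
  intro S T h
  apply Subtype.ext
  funext p
  by_cases hp : p ∈ pcells l
  · have := congrFun h ⟨p, hp⟩
    simpa using this
  · rw [S.2.2.2.2 p hp, T.2.2.2.2 p hp]

lemma premove_part {l : ℕ → ℕ} (hl : IsPart l) {r : ℕ} (hr : l (r + 1) < l r) :
    IsPart (premove l r) := by
  refine ⟨fun i => ?_, ?_⟩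
  · have := hl.1 i
    unfold premove
    simp only [Function.update_apply]
    split_ifs with h1 h2 h2
    · omega
    · subst h1; omega
    · subst h2; omega
    · exact this
  · obtain ⟨N, hN⟩ := hl.2
    refine ⟨N, fun i hi => ?_⟩
    have := hN i hi
    unfold premove
    simp only [Function.update_apply]
    split_ifs with h1
    · subst h1; omega
    · exact this

lemma premove_self (l : ℕ → ℕ) (r : ℕ) : premove l r r = l r - 1 := by simp [premove]

lemma premove_ne (l : ℕ → ℕ) {r i : ℕ} (h : i ≠ r) : premove l r i = l i := by
  simp [premove, h]

lemma pcells_premove {l : ℕ → ℕ} {r : ℕ} (hr : l (r + 1) < l r) :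
    pcells l = insert (r, l r - 1) (pcells (premove l r)) := by
  ext ⟨i, j⟩
  simp only [pcells, Set.mem_ofPred_eq, Set.mem_insert_iff, Prod.mk.injEq]
  by_cases h : i = r
  · subst h; rw [premove_self]; omega
  · rw [premove_ne l h]; simp [h]

lemma corner_notMem (l : ℕ → ℕ) (r : ℕ) : (r, l r - 1) ∉ pcells (premove l r) := by
  simp [pcells, premove_self]

lemma psize_premove {l : ℕ → ℕ} (hl : IsPart l) {r : ℕ} (hr : l (r + 1) < l r) :
    psize l = psize (premove l r) + 1 := by
  rw [psize, psize, pcells_premove hr, Nat.card_coe_set_eq, Nat.card_coe_set_eq]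
  exact Set.ncard_insert_of_notMem (corner_notMem l r) (pcells_finite (premove_part hl hr))

lemma syt_le {l : ℕ → ℕ} {T : ℕ × ℕ → ℕ} (hT : IsSYT l T) (p : ℕ × ℕ) : T p ≤ psize l := by
  by_cases hp : p ∈ pcells l
  · exact (hT.1.mapsTo hp).2
  · rw [hT.2.2.2 p hp]; omega

lemma syt_extend {l : ℕ → ℕ} (hl : IsPart l) {r : ℕ} (hr : l (r + 1) < l r)
    {T : ℕ × ℕ → ℕ} (hT : IsSYT (premove l r) T) :
    IsSYT l (Function.update T (r, l r - 1) (psize l)) := by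
  have hs := psize_premove hl hr
  have hc := corner_notMem l r
  have hle := syt_le hT
  have hne : ∀ p ∈ pcells (premove l r), p ≠ (r, l r - 1) := by
    rintro p hp rfl; exact hc hp
  obtain ⟨hb, hrow, hcol, h0⟩ := hT
  refine ⟨?_, ?_, ?_, ?_⟩
  · have h1 : Set.BijOn (Function.update T (r, l r - 1) (psize l)) (pcells (premove l r))
        (Set.Icc 1 (psize (premove l r))) := by
      refine hb.congr ?_
      intro p hp
      rw [Function.update_of_ne (hne p hp)]
    have h2 := h1.insert (a := (r, l r - 1)) (by simp; omega)
    rw [← pcells_premove hr, Function.update_self] at h2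
    convert h2 using 1
    ext x
    simp only [Set.mem_Icc, Set.mem_insert_iff]
    omega
  · intro p hp q hq e hlt
    rw [pcells_premove hr] at hp
    have hq' := hq
    rw [pcells_premove hr] at hq
    rcases hp with rfl | hp
    · simp only [pcells, Set.mem_ofPred_eq] at hq'
      simp only at e hlt
      rw [← e] at hq'
      omega
    · rw [Function.update_of_ne (hne p hp)]
      rcases hq with rfl | hq
      · rw [Function.update_self]; have := hle p; omega
      · rw [Function.update_of_ne (hne q hq)]
        exact hrow p hp q hq e hlt
  · intro p hp q hq e hlt
    rw [pcells_premove hr] at hp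
    have hq' := hq
    rw [pcells_premove hr] at hq
    rcases hp with rfl | hp
    · simp only [pcells, Set.mem_ofPred_eq] at hq'
      simp only at e hlt
      have := ispart_anti hl (Nat.succ_le_of_lt hlt)
      simp only [Nat.succ_eq_add_one] at this
      omega
    · rw [Function.update_of_ne (hne p hp)]
      rcases hq with rfl | hq
      · rw [Function.update_self]; have := hle p; omega
      · rw [Function.update_of_ne (hne q hq)]
        exact hcol p hp q hq e hlt
  · intro p hp
    rw [pcells_premove hr, Set.mem_insert_iff, not_or] at hp
    rw [Function.update_of_ne hp.1]
    exact h0 p hp.2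

lemma branch {l : ℕ → ℕ} (hl : IsPart l) (D : Finset ℕ) (hD : ∀ r ∈ D, l (r + 1) < l r) :
    ∑ r ∈ D, sytCount (premove l r) ≤ sytCount l := by
  have := syt_finite hl
  have hf : ∀ r : D, Finite {T : ℕ × ℕ → ℕ // IsSYT (premove l r) T} := fun r =>
    syt_finite (premove_part hl (hD r r.2))
  rw [← Finset.sum_coe_sort]
  unfold sytCount
  rw [← Nat.card_sigma]
  refine Nat.card_le_card_of_injective
    (fun x : (Σ r : D, {T : ℕ × ℕ → ℕ // IsSYT (premove l r) T}) =>
      (⟨_, syt_extend hl (hD x.1 x.1.2) x.2.2⟩ : {T : ℕ × ℕ → ℕ // IsSYT l T})) ?_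
  rintro ⟨⟨r, hr⟩, T, hT⟩ ⟨⟨s, hs⟩, S, hS⟩ h
  simp only [Subtype.mk.injEq] at h
  have e : r = s := by
    by_contra hne
    have h1 := congrFun h (r, l r - 1)
    rw [Function.update_self, Function.update_of_ne (by simp [hne])] at h1
    have h2 := syt_le hS (r, l r - 1)
    have h3 := psize_premove hl (hD s hs)
    simp only at h2; omega
  subst e
  have e2 : T = S := by
    funext p
    by_cases hp : p = (r, l r - 1)
    · subst hp
      rw [hT.2.2.2 _ (corner_notMem l r), hS.2.2.2 _ (corner_notMem l r)]
    · have h1 := congrFun h p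
      rwa [Function.update_of_ne hp, Function.update_of_ne hp] at h1
  subst e2
  rfl

lemma branch1 {l : ℕ → ℕ} (hl : IsPart l) {r : ℕ} (hr : l (r + 1) < l r) :
    sytCount (premove l r) ≤ sytCount l := by
  have := branch hl {r} (by simpa using hr)
  simpa using this

lemma branch2 {l : ℕ → ℕ} (hl : IsPart l) {r s : ℕ} (hrs : r ≠ s) (hr : l (r + 1) < l r)
    (hs : l (s + 1) < l s) :
    sytCount (premove l r) + sytCount (premove l s) ≤ sytCount l := by
  have := branch hl {r, s} (by
    intro x hx
    simp only [Finset.mem_insert, Finset.mem_singleton] at hx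
    rcases hx with rfl | rfl <;> assumption)
  rwa [Finset.sum_pair hrs] at this

/-- the last row whose length is at least `c` -/
lemma last_row {l : ℕ → ℕ} (hl : IsPart l) {c a : ℕ} (hc : 0 < c) (ha : c ≤ l a) :
    ∃ r, a ≤ r ∧ c ≤ l r ∧ l (r + 1) < c := by
  obtain ⟨N, hN⟩ := hl.2
  have hex : ∃ k, l (a + k) < c := ⟨N, by rw [hN _ (by omega)]; exact hc⟩
  classical
  have h1 := Nat.find_spec hex
  rcases hk : Nat.find hex with _ | k
  · rw [hk] at h1; simp at h1; omega
  · rw [hk] at h1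
    refine ⟨a + k, by omega, ?_, h1⟩
    have := Nat.find_min hex (m := k) (by omega)
    omega

lemma syt_pos : ∀ (n : ℕ) (l : ℕ → ℕ), IsPart l → psize l = n → 1 ≤ sytCount l := by
  intro n
  induction n with
  | zero =>
    intro l hl hn
    have := syt_finite hl
    have he : pcells l = ∅ := by
      rw [psize, Nat.card_coe_set_eq, Set.ncard_eq_zero (pcells_finite hl)] at hn
      exact hn
    refine Nat.card_pos_iff.2 ⟨⟨⟨fun _ => 0, ?_⟩⟩, this⟩
    refine ⟨?_, ?_, ?_, fun _ _ => rfl⟩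
    · rw [he, hn]; simp
    · simp [he]
    · simp [he]
  | succ n ih =>
    intro l hl hn
    have h0 : 1 ≤ l 0 := by
      by_contra hc
      have := psize_sum (l := l) 0 (fun i _ => by have := ispart_anti hl (Nat.zero_le i); omega)
      simp at this; omega
    obtain ⟨r, -, h1, h2⟩ := last_row hl one_pos h0
    have hr : l (r + 1) < l r := by omega
    have := ih _ (premove_part hl hr) (by have := psize_premove hl hr; omega)
    exact this.trans (branch1 hl hr)

lemma syt_ge_row : ∀ (n : ℕ) (l : ℕ → ℕ), IsPart l → psize l = n → 1 ≤ l 1 →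
    l 0 ≤ sytCount l := by
  intro n
  induction n with
  | zero =>
    intro l hl hn h1
    obtain ⟨r, -, h1, h2⟩ := last_row hl one_pos h1
    have := psize_premove hl (r := r) (by omega)
    omega
  | succ n ih =>
    intro l hl hn h1
    have h01 := hl.1 0
    have h12 := hl.1 1
    simp only [zero_add] at h01
    norm_num at h12
    obtain ⟨r, hr1, hr2, hr3⟩ := last_row hl one_pos h1
    have hr : l (r + 1) < l r := by omega
    have hp := psize_premove hl hr
    by_cases hbig : 2 ≤ r ∨ 2 ≤ l 1
    · have := ih _ (premove_part hl hr) (by omega) (by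
        by_cases h : 1 = r
        · subst h; rw [premove_self]; omega
        · rw [premove_ne l h]; exact h1)
      rw [premove_ne l (by omega : 0 ≠ r)] at this
      exact this.trans (branch1 hl hr)
    · have hr' : r = 1 := by omega
      subst hr'
      by_cases hm : l 0 ≤ 1
      · exact hm.trans (syt_pos _ l hl hn)
      · have h0 : l (0 + 1) < l 0 := by simp only [zero_add]; omega
        have hp0 := psize_premove hl h0
        have a := ih _ (premove_part hl h0) (by omega) (by
          rw [premove_ne l (by omega)]; exact h1)
        rw [premove_self] at a
        have b := syt_pos _ _ (premove_part hl hr) rfl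
        have := branch2 hl (by omega : 0 ≠ 1) h0 hr
        omega

lemma syt_ge_col : ∀ (n : ℕ) (l : ℕ → ℕ) (k : ℕ), IsPart l → psize l = n → 2 ≤ l 0 → 1 ≤ l k →
    k + 1 ≤ sytCount l := by
  intro n
  induction n with
  | zero =>
    intro l k hl hn h1 h2
    obtain ⟨r, -, h1, h2⟩ := last_row hl one_pos h2
    have := psize_premove hl (r := r) (by omega)
    omega
  | succ n ih =>
    intro l k hl hn h0 hk
    have h01 := hl.1 0
    simp only [zero_add] at h01
    obtain ⟨r, hr1, hr2, hr3⟩ := last_row hl (by omega : 0 < l 0) le_rfl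
    have hrle := ispart_anti hl hr1
    have hr : l (r + 1) < l r := by omega
    have hp := psize_premove hl hr
    by_cases hbig : 3 ≤ l 0 ∨ 2 ≤ l 1
    · have hr0 : 3 ≤ l 0 ∨ r ≠ 0 := by
        by_contra hc
        push Not at hc
        obtain ⟨hc, rfl⟩ := hc
        simp only [zero_add] at hr
        omega
      have := ih _ k (premove_part hl hr) (by omega) (by
        by_cases h : 0 = r
        · subst h; rw [premove_self]; omega
        · rw [premove_ne l h]; exact h0) (by
        by_cases h : k = r
        · subst h; rw [premove_self]; omega
        · rw [premove_ne l h]; exact hk)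
      exact this.trans (branch1 hl hr)
    · have h0' : l (0 + 1) < l 0 := by simp only [zero_add]; omega
      rcases Nat.eq_zero_or_pos k with rfl | hkp
      · exact syt_pos _ l hl hn
      · obtain ⟨s, hs1, hs2, hs3⟩ := last_row hl one_pos hk
        have hs : l (s + 1) < l s := by omega
        have hps := psize_premove hl hs
        have a := ih _ (k - 1) (premove_part hl hs) (by omega) (by
          rw [premove_ne l (by omega)]; exact h0) (by
          rw [premove_ne l (by omega)]; exact hk.trans (ispart_anti hl (by omega)))
        have b := syt_pos _ _ (premove_part hl h0') rfl
        have := branch2 hl (by omega : 0 ≠ s) h0' hs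
        omega

lemma chain_unique {l : ℕ → ℕ} (hl : IsPart l) (c : ℕ → ℕ × ℕ) (m : ℕ)
    (hc : pcells l = c '' Set.Iio m) (hm : psize l ≤ m)
    (hlt : ∀ T, IsSYT l T → ∀ i, i + 1 < m → T (c i) < T (c (i + 1))) :
    sytCount l = 1 := by
  have key : ∀ T, IsSYT l T → ∀ i, i < m → T (c i) = i + 1 := by
    intro T hT i hi
    have lo : ∀ i, i < m → i + 1 ≤ T (c i) := by
      intro i
      induction i with
      | zero => intro hi; exact (hT.1.mapsTo (hc ▸ ⟨0, hi, rfl⟩)).1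
      | succ i ih => intro hi; have := hlt T hT i hi; have := ih (by omega); omega
    have up : ∀ d i, i + d + 1 = m → T (c i) + d ≤ m := by
      intro d
      induction d with
      | zero => intro i _; have := syt_le hT (c i); omega
      | succ d ih => intro i hi; have := hlt T hT i (by omega); have := ih (i + 1) (by omega); omega
    have := lo i hi
    have := up (m - 1 - i) i (by omega)
    omega
  have hpos := syt_pos _ l hl rfl
  have : sytCount l ≤ 1 := by
    have := syt_finite hl
    refine Finite.card_le_one_iff_subsingleton.2 ⟨?_⟩
    rintro ⟨S, hS⟩ ⟨T, hT⟩
    apply Subtype.ext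
    funext p
    by_cases hp : p ∈ pcells l
    · rw [hc] at hp
      obtain ⟨i, hi, rfl⟩ := hp
      simp only [key S hS i hi, key T hT i hi]
    · simp only [hS.2.2.2 p hp, hT.2.2.2 p hp]
  omega

lemma row_one {l : ℕ → ℕ} (hl : IsPart l) (h : l 1 = 0) : sytCount l = 1 := by
  have hz : ∀ i, 1 ≤ i → l i = 0 := fun i hi => by have := ispart_anti hl hi; omega
  refine chain_unique hl (fun j => (0, j)) (l 0) ?_ ?_ ?_
  · ext ⟨i, j⟩
    simp only [pcells, Set.mem_ofPred_eq, Set.mem_image, Set.mem_Iio, Prod.mk.injEq]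
    constructor
    · intro hij
      have : i = 0 := by
        by_contra hc; rw [hz i (by omega)] at hij; omega
      subst this
      exact ⟨j, hij, rfl, rfl⟩
    · rintro ⟨a, ha, rfl, rfl⟩; exact ha
  · rw [psize_sum 1 hz]; simp
  · intro T hT i hi
    exact hT.2.1 _ (by simp [pcells]; omega) _ (by simp [pcells]; omega) rfl (by simp)

lemma col_one {l : ℕ → ℕ} (hl : IsPart l) (h : l 0 ≤ 1) (h1 : 1 ≤ l 0) : sytCount l = 1 := by
  obtain ⟨r, -, hr2, hr3⟩ := last_row hl one_pos h1
  have hz : ∀ i, r + 1 ≤ i → l i = 0 := fun i hi => by have := ispart_anti hl hi; omega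
  have ho : ∀ i, i < r + 1 → l i = 1 := fun i hi => by
    have := ispart_anti hl (Nat.zero_le i)
    have := ispart_anti hl (by omega : i ≤ r)
    omega
  refine chain_unique hl (fun j => (j, 0)) (r + 1) ?_ ?_ ?_
  · ext ⟨i, j⟩
    simp only [pcells, Set.mem_ofPred_eq, Set.mem_image, Set.mem_Iio, Prod.mk.injEq]
    constructor
    · intro hij
      have : i < r + 1 := by
        by_contra hc; rw [hz i (by omega)] at hij; omega
      rw [ho i this] at hij
      exact ⟨i, this, rfl, by omega⟩
    · rintro ⟨a, ha, rfl, rfl⟩; rw [ho a ha]; omega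
  · rw [psize_sum (r + 1) hz, Finset.sum_congr rfl (fun i hi => ho i (Finset.mem_range.1 hi))]
    simp
  · intro T hT i hi
    exact hT.2.2.1 _ (by simp [pcells, ho i (by omega)]) _ (by simp [pcells, ho (i + 1) hi]) rfl
      (by simp)

lemma syt_ge_three {l : ℕ → ℕ} (hl : IsPart l) (h0 : 2 ≤ l 0) (h1 : 1 ≤ l 1)
    (hn : 5 ≤ psize l) : 3 ≤ sytCount l := by
  by_cases h3 : 3 ≤ l 0
  · exact h3.trans (syt_ge_row _ l hl rfl h1)
  by_cases h2 : 1 ≤ l 2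
  · exact syt_ge_col _ l 2 hl rfl h0 h2
  have := psize_sum (l := l) 2 (fun i hi => by have := ispart_anti hl hi; omega)
  have h01 := ispart_anti hl (by omega : 0 ≤ 1)
  simp [Finset.sum_range_succ] at this
  omega

/-- If `λ ⊢ n` with `n ≥ 6` and `f(λ) ≠ 1`, then `f(λ) > 2·δ(λ)`. -/
theorem dim_gt_two_delta (n : ℕ) (hn : 6 ≤ n) (l : ℕ → ℕ) (hl : IsPart l)
    (hsize : psize l = n) (hdim : sytCount l ≠ 1) :
    2 * pdelta l < sytCount l := by
  have anti := ispart_anti hl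
  have h1 : 1 ≤ l 1 := by
    by_contra hc
    exact hdim (row_one hl (by omega))
  have h01 := anti (by omega : 0 ≤ 1)
  have h0 : 2 ≤ l 0 := by
    by_contra hc
    exact hdim (col_one hl (by omega) (by omega))
  have hfin : {r : ℕ | l (r + 1) < l r}.Finite := by
    obtain ⟨N, hN⟩ := hl.2
    refine (Set.finite_Iio N).subset ?_
    intro r hr
    by_contra hc
    simp only [Set.mem_Iio, not_lt] at hc
    simp only [Set.mem_ofPred_eq, hN r hc] at hr
    omega
  have hd : pdelta l = hfin.toFinset.card := by
    rw [pdelta, Nat.card_coe_set_eq, Set.ncard_eq_toFinset_card _ hfin]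
  have hmem : ∀ r ∈ hfin.toFinset, l (r + 1) < l r := by
    intro r hr; simpa using hr
  by_cases hA : l 0 = 2 ∧ l 1 = 1
  · have hdle : pdelta l ≤ 2 := by
      rw [hd]
      have : hfin.toFinset.card ≤ (Finset.Icc 1 2).card := by
        refine Finset.card_le_card_of_injOn l ?_ ?_
        · intro r hr
          have := hmem r hr
          have := anti (Nat.zero_le r)
          simp only [Finset.coe_Icc, Set.mem_Icc]
          omega
        · intro r hr s hs e
          have a := hmem r hr
          have b := hmem s hs
          rcases lt_trichotomy r s with h | h | h
          · have := anti (show r + 1 ≤ s by omega); omega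
          · exact h
          · have := anti (show s + 1 ≤ r by omega); omega
      simpa using this
    have h4 : 1 ≤ l 4 := by
      by_contra hc
      have := psize_sum (l := l) 4 (fun i hi => by have := anti hi; omega)
      have := anti (by omega : 1 ≤ 2)
      have := anti (by omega : 1 ≤ 3)
      simp [Finset.sum_range_succ] at *
      omega
    have := syt_ge_col _ l 4 hl rfl h0 h4
    omega
  by_cases hB : l 1 = 1 ∧ l 2 = 0
  · have hz : ∀ i, 2 ≤ i → l i = 0 := fun i hi => by have := anti hi; omega
    have hdle : pdelta l ≤ 2 := by
      rw [hd]
      have : hfin.toFinset ⊆ Finset.range 2 := by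
        intro r hr
        have := hmem r hr
        by_contra hc
        rw [hz r (by simp at hc; omega)] at this
        omega
      simpa using Finset.card_le_card this
    have := psize_sum 2 hz
    simp [Finset.sum_range_succ] at this
    have := syt_ge_row _ l hl rfl h1
    omega
  have hsum := branch hl hfin.toFinset hmem
  have h3 : hfin.toFinset.card * 3 ≤ ∑ r ∈ hfin.toFinset, sytCount (premove l r) := by
    rw [← smul_eq_mul]
    refine Finset.card_nsmul_le_sum _ _ _ ?_
    intro r hr
    have hr := hmem r hr
    have hp := psize_premove hl hr
    refine syt_ge_three (premove_part hl hr) ?_ ?_ (by omega)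
    · by_cases h : 0 = r
      · subst h; rw [premove_self]; simp only [zero_add] at hr; omega
      · rw [premove_ne l h]; exact h0
    · by_cases h : 1 = r
      · subst h; rw [premove_self]; norm_num at hr; omega
      · rw [premove_ne l h]; exact h1
  have := syt_pos _ l hl rfl
  omega
end
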